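/- Let T > 0, let p ≥ 0 be an integer, and let l be a positive integer with (p+1)/l < T/4. Define φ_p(σ) = σ^{2p+1} e^{−Tσ²} and φ_p^l(σ) = σ^{2p+1} e^{−Tσ²} ( (e^{σ²/l} − 1)/(σ²/l) )^{p+1} for σ ∈ ℝ (with the convention that the last factor equals 1 at σ = 0). Then ‖φ_p^l − φ_p‖_{L²(ℝ)} ≤ (1/(2πT))^{1/4} · (√(p+2)/l) · (2^{p+1/2}/T^{p+3/2}) · (p+2)!. -/

import Mathlib

open MeasureTheory Set Filter
open scoped Topology

/-- `φ_p(σ) = σ^{2p+1} e^{−Tσ²}`. -/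
noncomputable def phiFun (T : ℝ) (p : ℕ) (σ : ℝ) : ℝ :=
  σ ^ (2 * p + 1) * Real.exp (-T * σ ^ 2)

/-- `φ_p^l(σ) = σ^{2p+1} e^{−Tσ²} ((e^{σ²/l} − 1)/(σ²/l))^{p+1}`, with the convention
that the last factor equals `1` at `σ = 0`. -/
noncomputable def phiFunApprox (T : ℝ) (p l : ℕ) (σ : ℝ) : ℝ :=
  σ ^ (2 * p + 1) * Real.exp (-T * σ ^ 2) *
    (if σ = 0 then 1 else ((Real.exp (σ ^ 2 / l) - 1) / (σ ^ 2 / l)) ^ (p + 1))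

lemma aux_pow (E : ℝ) (hE : 1 ≤ E) (n : ℕ) :
    E ^ (n + 1) - 1 ≤ (n + 1) * E ^ n * (E - 1) := by
  induction n with
  | zero => simp
  | succ n ih =>
    have h1 : 1 ≤ E ^ (n + 1) := one_le_pow₀ hE
    have h2 : E * (E ^ (n + 1) - 1) ≤ E * ((n + 1) * E ^ n * (E - 1)) :=
      mul_le_mul_of_nonneg_left ih (by linarith)
    have h3 : 0 ≤ (E ^ (n + 1) - 1) * (E - 1) := mul_nonneg (by linarith) (by linarith)
    push_cast
    have e1 : E ^ (n + 1 + 1) = E * E ^ (n + 1) := by ring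
    have e2 : E * ((n + 1) * E ^ n * (E - 1)) = (n + 1) * E ^ (n + 1) * (E - 1) := by ring
    rw [e1]
    rw [e2] at h2
    nlinarith

lemma aux_exp (z : ℝ) (hz : 0 < z) (p : ℕ) :
    0 ≤ ((Real.exp z - 1) / z) ^ (p + 1) - 1 ∧
    ((Real.exp z - 1) / z) ^ (p + 1) - 1 ≤ (p + 1) * z * Real.exp ((p + 1) * z) := by
  have h0 : Real.exp z - 1 ≤ z * Real.exp z := by
    have h1 := Real.add_one_le_exp (-z)
    have h2 : Real.exp (-z) * Real.exp z = 1 := by rw [← Real.exp_add]; simp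
    nlinarith [Real.exp_pos z]
  have hE1 : 1 ≤ (Real.exp z - 1) / z := by
    rw [le_div_iff₀ hz]; linarith [Real.add_one_le_exp z]
  have hE2 : (Real.exp z - 1) / z ≤ Real.exp z := by
    rw [div_le_iff₀ hz]; linarith
  set E := (Real.exp z - 1) / z
  have hp : 1 ≤ E ^ (p + 1) := one_le_pow₀ hE1
  refine ⟨by linarith, (aux_pow E hE1 p).trans ?_⟩
  have e : Real.exp ((p + 1) * z) = Real.exp z ^ p * Real.exp z := by
    rw [← pow_succ, ← Real.exp_nat_mul]; push_cast; rfl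
  rw [e]
  calc ((p : ℝ) + 1) * E ^ p * (E - 1)
      ≤ (p + 1) * Real.exp z ^ p * (z * Real.exp z) := by
        gcongr
        · linarith
    _ = _ := by ring

lemma aux_gamma (p : ℕ) :
    Real.Gamma (2 * p + 7 / 2) ≤ 15 / 8 * √Real.pi * 4 ^ p * ((p + 1).factorial : ℝ) ^ 2 := by
  induction p with
  | zero =>
    have h1 : Real.Gamma (7 / 2) = 15 / 8 * √Real.pi := by
      rw [show (7 / 2 : ℝ) = 1 / 2 + 1 + 1 + 1 by norm_num, Real.Gamma_add_one (by norm_num),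
        Real.Gamma_add_one (by norm_num), Real.Gamma_add_one (by norm_num),
        Real.Gamma_one_half_eq]
      ring
    simp [h1]
  | succ p ih =>
    have hp : (0 : ℝ) ≤ p := p.cast_nonneg
    have e : (2 * ((p + 1 : ℕ) : ℝ) + 7 / 2) = (2 * p + 7 / 2) + 1 + 1 := by push_cast; ring
    rw [e, Real.Gamma_add_one (by positivity), Real.Gamma_add_one (by positivity)]
    rw [Nat.factorial_succ (p + 1)]
    push_cast
    have hG : 0 ≤ 15 / 8 * √Real.pi * 4 ^ p * ((p + 1).factorial : ℝ) ^ 2 := by positivity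
    calc (2 * (p : ℝ) + 7 / 2 + 1) * ((2 * p + 7 / 2) * Real.Gamma (2 * p + 7 / 2))
        ≤ (2 * (p : ℝ) + 7 / 2 + 1) * ((2 * p + 7 / 2) *
          (15 / 8 * √Real.pi * 4 ^ p * ((p + 1).factorial : ℝ) ^ 2)) := by gcongr
      _ = ((2 * (p : ℝ) + 7 / 2 + 1) * (2 * p + 7 / 2)) *
          (15 / 8 * √Real.pi * 4 ^ p * ((p + 1).factorial : ℝ) ^ 2) := by ring
      _ ≤ (4 * (p + 2) ^ 2) *
          (15 / 8 * √Real.pi * 4 ^ p * ((p + 1).factorial : ℝ) ^ 2) := by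
        apply mul_le_mul_of_nonneg_right _ hG
        nlinarith
      _ = _ := by ring

lemma aux_integral (T : ℝ) (hT : 0 < T) (p : ℕ) :
    ∫ x : ℝ, x ^ (4 * p + 6) * Real.exp (-T * x ^ 2) =
      Real.Gamma (2 * p + 7 / 2) / (T ^ (2 * p + 3) * √T) := by
  have h1 := integral_comp_abs (f := fun x : ℝ => x ^ (4 * p + 6) * Real.exp (-T * x ^ 2))
  have ev : Even (4 * p + 6) := ⟨2 * p + 3, by ring⟩
  simp only [ev.pow_abs, sq_abs] at h1
  rw [h1]
  have h2 := integral_rpow_mul_exp_neg_mul_rpow (p := 2) (q := ((4 * p + 6 : ℕ) : ℝ)) (b := T)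
    (by norm_num) (by have := (4 * p + 6).cast_nonneg (α := ℝ); linarith) hT
  have h3 : ∀ x : ℝ, x ^ (2 : ℝ) = x ^ 2 := fun x => by norm_cast
  simp only [Real.rpow_natCast, h3] at h2
  rw [h2]
  have e1 : (((4 * p + 6 : ℕ) : ℝ) + 1) / 2 = 2 * p + 7 / 2 := by push_cast; ring
  have e2 : -(((4 * p + 6 : ℕ) : ℝ) + 1) / 2 = -(((2 * p + 3 : ℕ) : ℝ) + 1 / 2) := by
    push_cast; ring
  rw [e1, e2, Real.rpow_neg hT.le, Real.rpow_add hT, Real.rpow_natCast, ← Real.sqrt_eq_rpow]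
  ring

lemma aux_pointwise (T : ℝ) (hT : 0 < T) (p l : ℕ) (hl : 1 ≤ l)
    (hpl : ((p : ℝ) + 1) / l < T / 4) (σ : ℝ) :
    (phiFunApprox T p l σ - phiFun T p σ) ^ 2 ≤
      ((p + 1) / l) ^ 2 * (σ ^ (4 * p + 6) * Real.exp (-T * σ ^ 2)) := by
  have hl' : (0 : ℝ) < l := by exact_mod_cast hl
  unfold phiFunApprox phiFun
  by_cases h : σ = 0
  · simp [h]
  rw [if_neg h]
  have hs : 0 < σ ^ 2 := by positivity
  obtain ⟨h1, h2⟩ := aux_exp (σ ^ 2 / l) (by positivity) p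
  set F := ((Real.exp (σ ^ 2 / l) - 1) / (σ ^ 2 / l)) ^ (p + 1)
  have h3 : F - 1 ≤ (p + 1) * (σ ^ 2 / l) * Real.exp (T / 4 * σ ^ 2) := by
    refine h2.trans ?_
    have : ((p : ℝ) + 1) * (σ ^ 2 / l) ≤ T / 4 * σ ^ 2 := by
      calc ((p : ℝ) + 1) * (σ ^ 2 / l) = (p + 1) / l * σ ^ 2 := by ring
        _ ≤ _ := by gcongr
    gcongr
  calc (σ ^ (2 * p + 1) * Real.exp (-T * σ ^ 2) * F - σ ^ (2 * p + 1) * Real.exp (-T * σ ^ 2)) ^ 2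
      = (σ ^ (2 * p + 1) * Real.exp (-T * σ ^ 2)) ^ 2 * (F - 1) ^ 2 := by ring
    _ ≤ (σ ^ (2 * p + 1) * Real.exp (-T * σ ^ 2)) ^ 2 *
        ((p + 1) * (σ ^ 2 / l) * Real.exp (T / 4 * σ ^ 2)) ^ 2 := by gcongr
    _ = ((p + 1) / l) ^ 2 * (σ ^ (4 * p + 6) *
        (Real.exp (-T * σ ^ 2) * Real.exp (T / 4 * σ ^ 2)) ^ 2) := by
        rw [show 4 * p + 6 = 2 * (2 * p + 1) + 4 by ring, pow_add σ, pow_mul' σ]; ring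
    _ ≤ _ := by
        have ev : Even (4 * p + 6) := ⟨2 * p + 3, by ring⟩
        have := ev.pow_nonneg σ
        have : (Real.exp (-T * σ ^ 2) * Real.exp (T / 4 * σ ^ 2)) ^ 2 ≤ Real.exp (-T * σ ^ 2) := by
          rw [← Real.exp_add, ← Real.exp_nat_mul]
          apply Real.exp_le_exp.mpr
          push_cast
          nlinarith [mul_pos hT hs]
        gcongr

/-- Quantitative bound:
`‖φ_p^l − φ_p‖_{L²(ℝ)} ≤ (1/(2πT))^{1/4} (√(p+2)/l) (2^{p+1/2}/T^{p+3/2}) (p+2)!`. -/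
theorem phiFunApprox_quantitative_bound
    (T : ℝ) (hT : 0 < T) (p l : ℕ) (hl : 1 ≤ l)
    (hpl : ((p : ℝ) + 1) / l < T / 4) :
    Real.sqrt (∫ σ : ℝ, (phiFunApprox T p l σ - phiFun T p σ) ^ 2)
      ≤ (1 / (2 * Real.pi * T)) ^ ((1:ℝ)/4) * (Real.sqrt ((p : ℝ) + 2) / l) *
          ((2:ℝ) ^ ((p : ℝ) + 1 / 2) / T ^ ((p : ℝ) + 3 / 2)) * ((p + 2).factorial : ℝ) := by
  have hl' : (0 : ℝ) < l := by exact_mod_cast hl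
  have hpi := Real.pi_pos
  apply Real.sqrt_le_iff.mpr
  refine ⟨by positivity, ?_⟩
  have hint : Integrable (fun σ : ℝ => σ ^ (4 * p + 6) * Real.exp (-T * σ ^ 2)) := by
    have := integrable_rpow_mul_exp_neg_mul_sq hT (s := ((4 * p + 6 : ℕ) : ℝ))
      (by have := (4 * p + 6).cast_nonneg (α := ℝ); linarith)
    simpa only [Real.rpow_natCast] using this
  have hI : ∫ σ : ℝ, (phiFunApprox T p l σ - phiFun T p σ) ^ 2 ≤
      ((p + 1) / l) ^ 2 * (Real.Gamma (2 * p + 7 / 2) / (T ^ (2 * p + 3) * √T)) := by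
    rw [← aux_integral T hT, ← integral_const_mul]
    apply integral_mono_of_nonneg
    · exact Eventually.of_forall fun σ => sq_nonneg _
    · exact hint.const_mul _
    · exact Eventually.of_forall fun σ => aux_pointwise T hT p l hl hpl σ
  refine hI.trans ?_
  have r1 : ((1 / (2 * Real.pi * T)) ^ ((1:ℝ)/4)) ^ 2 = 1 / (√2 * √Real.pi * √T) := by
    rw [← Real.rpow_natCast, ← Real.rpow_mul (by positivity),
      show (1:ℝ) / 4 * ((2 : ℕ) : ℝ) = 1 / 2 by norm_num, ← Real.sqrt_eq_rpow,
      Real.sqrt_div (by norm_num), Real.sqrt_one, Real.sqrt_mul (by positivity),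
      Real.sqrt_mul (by positivity)]
  have r2 : ((2:ℝ) ^ ((p : ℝ) + 1 / 2)) ^ 2 = 2 * 4 ^ p := by
    rw [← Real.rpow_natCast, ← Real.rpow_mul (by positivity),
      show ((p : ℝ) + 1 / 2) * ((2 : ℕ) : ℝ) = ((2 * p + 1 : ℕ) : ℝ) by push_cast; ring,
      Real.rpow_natCast, pow_succ, pow_mul]
    norm_num
    ring
  have r3 : (T ^ ((p : ℝ) + 3 / 2)) ^ 2 = T ^ (2 * p + 3) := by
    rw [← Real.rpow_natCast, ← Real.rpow_mul (by positivity),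
      show ((p : ℝ) + 3 / 2) * ((2 : ℕ) : ℝ) = ((2 * p + 3 : ℕ) : ℝ) by push_cast; ring,
      Real.rpow_natCast]
  rw [mul_pow, mul_pow, mul_pow, div_pow (√((p : ℝ) + 2)), div_pow ((2 : ℝ) ^ _), r1, r2, r3,
    Real.sq_sqrt (by positivity)]
  have hsT : 0 < √T := Real.sqrt_pos.mpr hT
  have hs2 : 0 < √(2 : ℝ) := Real.sqrt_pos.mpr (by norm_num)
  have hsp : 0 < √Real.pi := Real.sqrt_pos.mpr hpi
  have key : ((p : ℝ) + 1) ^ 2 * Real.Gamma (2 * p + 7 / 2) ≤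
      1 / (√2 * √Real.pi) * (p + 2) * (2 * 4 ^ p) * ((p + 2).factorial : ℝ) ^ 2 := by
    have hk : ((p : ℝ) + 1) ^ 2 * (15 / 8) * (√2 * Real.pi) ≤ 2 * (p + 2) ^ 3 := by
      have b1 : √(2 : ℝ) ≤ 1.5 := by
        rw [Real.sqrt_le_iff]; norm_num
      have b2 : √2 * Real.pi ≤ 1.5 * 3.2 := by
        have := Real.pi_lt_d2
        gcongr
        linarith
      have hp : (0 : ℝ) ≤ p := p.cast_nonneg
      have b3 : ((p : ℝ) + 1) ^ 2 * (15 / 8) * (√2 * Real.pi) ≤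
          ((p : ℝ) + 1) ^ 2 * (15 / 8) * (1.5 * 3.2) := by gcongr
      nlinarith [mul_nonneg (sq_nonneg ((p : ℝ) - 1)) hp, sq_nonneg ((p : ℝ) - 1)]
    have e : 1 / (√2 * √Real.pi) * ((p : ℝ) + 2) * (2 * 4 ^ p) * ((p + 2).factorial : ℝ) ^ 2
        = (2 * (p + 2) ^ 3) * (4 ^ p * ((p + 1).factorial : ℝ) ^ 2) / (√2 * √Real.pi) := by
      rw [Nat.factorial_succ (p + 1)]
      push_cast
      ring
    rw [e, le_div_iff₀ (by positivity)]
    calc ((p : ℝ) + 1) ^ 2 * Real.Gamma (2 * p + 7 / 2) * (√2 * √Real.pi)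
        ≤ ((p : ℝ) + 1) ^ 2 * (15 / 8 * √Real.pi * 4 ^ p * ((p + 1).factorial : ℝ) ^ 2)
          * (√2 * √Real.pi) := by
          gcongr
          exact aux_gamma p
      _ = ((p : ℝ) + 1) ^ 2 * (15 / 8) * (√2 * (√Real.pi) ^ 2)
          * (4 ^ p * ((p + 1).factorial : ℝ) ^ 2) := by ring
      _ ≤ _ := by
          rw [Real.sq_sqrt hpi.le]
          gcongr
  calc (((p : ℝ) + 1) / l) ^ 2 * (Real.Gamma (2 * p + 7 / 2) / (T ^ (2 * p + 3) * √T))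
      = (((p : ℝ) + 1) ^ 2 * Real.Gamma (2 * p + 7 / 2)) / (l ^ 2 * (T ^ (2 * p + 3) * √T)) := by
        field_simp
    _ ≤ (1 / (√2 * √Real.pi) * (p + 2) * (2 * 4 ^ p) * ((p + 2).factorial : ℝ) ^ 2) /
        (l ^ 2 * (T ^ (2 * p + 3) * √T)) := by gcongr
    _ = _ := by field_simp
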